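/- Let A be a standard graded k-algebra with graded Jacobson radical J = ⊕_{i≥1} A_i, let M be a finitely generated graded A-module generated in degree 0, and let ⋯ → P_n →d_n→ ⋯ → P₁ →d₁→ P₀ →d₀→ M → 0 be a minimal graded projective resolution of M. Then M is a δ-Koszul module (i.e. each P_n is generated in degree δ(n)) if and only if for all n ≥ 0, ker d_n ⊆ J^{δ(n+1)−δ(n)}·P_n and J·ker d_n = ker d_n ∩ J^{δ(n+1)−δ(n)+1}·P_n. -/

import Mathlib

/-- `jSMul I K` is the submodule `I·K` generated by the products `r • k`,
`r ∈ I`, `k ∈ K`. -/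
def jSMul {R : Type} [Ring R] {M : Type} [AddCommGroup M] [Module R M]
    (I : Ideal R) (K : Submodule R M) : Submodule R M :=
  Submodule.span R {x : M | ∃ r ∈ I, ∃ k ∈ K, x = r • k}

/-- `jPowSMul I n K` is the submodule `Iⁿ·K`. -/
def jPowSMul {R : Type} [Ring R] {M : Type} [AddCommGroup M] [Module R M]
    (I : Ideal R) : ℕ → Submodule R M → Submodule R M
  | 0, K => K
  | n + 1, K => jSMul I (jPowSMul I n K)

/-- The graded Jacobson radical `J = ⊕_{i ≥ 1} A_i` of a graded algebra. -/
def gradedRad {k : Type} [Field k] {A : Type} [Ring A] [Algebra k A]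
    (𝒜 : ℕ → Submodule k A) : Ideal A :=
  Submodule.span A (⋃ i ∈ Set.Ici 1, (𝒜 i : Set A))

/-- `A`, graded by `𝒜`, is a standard graded `k`-algebra: `A₀` is a finite
product of copies of `k`, `A_i·A_j = A_{i+j}` and each `A_i` is
finite-dimensional over `k`. -/
def IsStandardGraded (k : Type) [Field k] (A : Type) [Ring A] [Algebra k A]
    (𝒜 : ℕ → Submodule k A) [GradedAlgebra 𝒜] : Prop :=
  (∃ m : ℕ, Nonempty ((𝒜 0) ≃ₐ[k] (Fin m → k))) ∧
  (∀ i j, 𝒜 i * 𝒜 j = 𝒜 (i + j)) ∧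
  (∀ i, FiniteDimensional k (𝒜 i))

/-- A minimal graded projective resolution `⋯ → P₁ → P₀ → X → 0` of a graded
module `X` (graded by `𝒳`) over a graded algebra `(A, 𝒜)`: each `Pₙ` is a
finitely generated graded projective `A`-module, all the maps are `A`-linear
of degree zero, the sequence is exact, and `ker dₙ ⊆ J·Pₙ` for all `n`, where
`J = ⊕_{i≥1} A_i`. -/
structure MinGradedProjRes (k : Type) [Field k] (A : Type) [Ring A]
    [Algebra k A] (𝒜 : ℕ → Submodule k A)
    (X : Type) [AddCommGroup X] [Module A X] (𝒳 : ℕ → AddSubgroup X) where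
  obj : ℕ → Type
  [addcomm : ∀ n, AddCommGroup (obj n)]
  [mod : ∀ n, Module A (obj n)]
  /-- the grading of the `n`-th term -/
  gr : ∀ n, ℕ → AddSubgroup (obj n)
  [decomp : ∀ n, DirectSum.Decomposition (gr n)]
  gsmul : ∀ n, SetLike.GradedSMul 𝒜 (gr n)
  proj : ∀ n, Module.Projective A (obj n)
  fin : ∀ n, Module.Finite A (obj n)
  d : ∀ n, obj (n + 1) →ₗ[A] obj n
  aug : obj 0 →ₗ[A] X
  d_graded : ∀ n i x, x ∈ gr (n + 1) i → d n x ∈ gr n i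
  aug_graded : ∀ i x, x ∈ gr 0 i → aug x ∈ 𝒳 i
  aug_surj : Function.Surjective aug
  exact0 : LinearMap.range (d 0) = LinearMap.ker aug
  exact : ∀ n, LinearMap.range (d (n + 1)) = LinearMap.ker (d n)
  minimal0 : LinearMap.ker aug ≤ jSMul (gradedRad 𝒜) ⊤
  minimal : ∀ n, LinearMap.ker (d n) ≤ jSMul (gradedRad 𝒜) ⊤

attribute [instance] MinGradedProjRes.addcomm MinGradedProjRes.mod
  MinGradedProjRes.decomp

/-- The syzygies of a minimal graded projective resolution:
`P.syz n ⊆ Pₙ` is `Ω^{n+1}(X) = ker dₙ`. -/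
def MinGradedProjRes.syz {k : Type} [Field k] {A : Type} [Ring A]
    [Algebra k A] {𝒜 : ℕ → Submodule k A}
    {X : Type} [AddCommGroup X] [Module A X] {𝒳 : ℕ → AddSubgroup X}
    (P : MinGradedProjRes k A 𝒜 X 𝒳) : ∀ n, Submodule A (P.obj n)
  | 0 => LinearMap.ker P.aug
  | n + 1 => LinearMap.ker (P.d n)

/-- The `n`-th term of the resolution is generated in degree `e`. -/
def MinGradedProjRes.GenInDeg {k : Type} [Field k] {A : Type} [Ring A]
    [Algebra k A] {𝒜 : ℕ → Submodule k A}
    {X : Type} [AddCommGroup X] [Module A X] {𝒳 : ℕ → AddSubgroup X}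
    (P : MinGradedProjRes k A 𝒜 X 𝒳) (n e : ℕ) : Prop :=
  Submodule.span A ((P.gr n e : Set (P.obj n))) = ⊤

section GradedModules

variable {k : Type} [Field k] {A : Type} [Ring A] [Algebra k A] {𝒜 : ℕ → Submodule k A}
variable {X : Type} [AddCommGroup X] [Module A X]
variable {Y : Type} [AddCommGroup Y] [Module A Y]

theorem smul_mem_jSMul {I : Ideal A} {K : Submodule A X} {r : A} {x : X}
    (hr : r ∈ I) (hx : x ∈ K) : r • x ∈ jSMul I K :=
  Submodule.subset_span ⟨r, hr, x, hx, rfl⟩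

theorem jSMul_le {I : Ideal A} {K L : Submodule A X}
    (h : ∀ r ∈ I, ∀ x ∈ K, r • x ∈ L) : jSMul I K ≤ L := by
  refine Submodule.span_le.2 ?_
  rintro _ ⟨r, hr, x, hx, rfl⟩
  exact h r hr x hx

theorem jSMul_mono (I : Ideal A) {K L : Submodule A X} (h : K ≤ L) : jSMul I K ≤ jSMul I L :=
  jSMul_le fun _ hr _ hx => smul_mem_jSMul hr (h hx)

theorem jSMul_le_self (I : Ideal A) (K : Submodule A X) : jSMul I K ≤ K :=
  jSMul_le fun r _ _ hx => K.smul_mem r hx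

theorem map_jSMul (I : Ideal A) (f : X →ₗ[A] Y) (K : Submodule A X) :
    (jSMul I K).map f = jSMul I (K.map f) := by
  apply le_antisymm
  · rw [Submodule.map_le_iff_le_comap]
    refine jSMul_le fun r hr x hx => ?_
    rw [Submodule.mem_comap, map_smul]
    exact smul_mem_jSMul hr (Submodule.mem_map_of_mem hx)
  · refine jSMul_le ?_
    rintro r hr _ ⟨x, hx, rfl⟩
    rw [← map_smul]
    exact Submodule.mem_map_of_mem (smul_mem_jSMul hr hx)

theorem mem_gradedRad {i : ℕ} (hi : 1 ≤ i) {a : A} (ha : a ∈ 𝒜 i) : a ∈ gradedRad 𝒜 :=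
  Submodule.subset_span (Set.mem_biUnion (Set.mem_Ici.2 hi) ha)

/-- The projection of a graded module onto its `i`-th homogeneous component. -/
def gradedProj (𝒢 : ℕ → AddSubgroup X) [DirectSum.Decomposition 𝒢] (i : ℕ) : X →+ X where
  toFun x := DirectSum.decompose 𝒢 x i
  map_zero' := by simp
  map_add' x y := by simp

section Proj

variable (𝒢 : ℕ → AddSubgroup X) [DirectSum.Decomposition 𝒢]

theorem gradedProj_mem (i : ℕ) (x : X) : gradedProj 𝒢 i x ∈ 𝒢 i :=
  (DirectSum.decompose 𝒢 x i).2

variable {𝒢}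

theorem gradedProj_of_mem {i : ℕ} {x : X} (hx : x ∈ 𝒢 i) : gradedProj 𝒢 i x = x :=
  DirectSum.decompose_of_mem_same 𝒢 hx

theorem gradedProj_of_mem_ne {i j : ℕ} {x : X} (hx : x ∈ 𝒢 i) (hij : i ≠ j) :
    gradedProj 𝒢 j x = 0 :=
  DirectSum.decompose_of_mem_ne 𝒢 hx hij

theorem mem_of_gradedProj_mem {H : AddSubgroup X} {x : X}
    (h : ∀ i, gradedProj 𝒢 i x ∈ H) : x ∈ H := by
  classical
  rw [← DirectSum.sum_support_decompose 𝒢 x]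
  exact sum_mem fun i _ => h i

theorem gradedProj_map {𝒦 : ℕ → AddSubgroup Y} [DirectSum.Decomposition 𝒦] {f : X →ₗ[A] Y}
    (hf : ∀ i x, x ∈ 𝒢 i → f x ∈ 𝒦 i) (i : ℕ) (x : X) :
    gradedProj 𝒦 i (f x) = f (gradedProj 𝒢 i x) := by
  induction x using DirectSum.Decomposition.inductionOn 𝒢 with
  | zero => simp
  | add x y hx hy => simp [hx, hy]
  | @homogeneous j m =>
    by_cases hij : j = i
    · subst hij
      rw [gradedProj_of_mem m.2, gradedProj_of_mem (hf _ _ m.2)]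
    · rw [gradedProj_of_mem_ne m.2 hij, gradedProj_of_mem_ne (hf _ _ m.2) hij, map_zero]

variable [GradedAlgebra 𝒜]

/-- The elements of a graded module all of whose components of degree less than `e` vanish. -/
def degGE (𝒢 : ℕ → AddSubgroup X) [DirectSum.Decomposition 𝒢] (e : ℕ) : AddSubgroup X where
  carrier := {x | ∀ i < e, gradedProj 𝒢 i x = 0}
  zero_mem' := by simp
  add_mem' hx hy i hi := by rw [map_add, hx i hi, hy i hi, add_zero]
  neg_mem' hx i hi := by rw [map_neg, hx i hi, neg_zero]

theorem degGE_anti {d e : ℕ} (h : d ≤ e) : degGE 𝒢 e ≤ degGE 𝒢 d :=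
  fun _ hx i hi => hx i (hi.trans_le h)

theorem mem_degGE_of_mem {i e : ℕ} (h : e ≤ i) {x : X} (hx : x ∈ 𝒢 i) : x ∈ degGE 𝒢 e :=
  fun _ hj => gradedProj_of_mem_ne hx (by omega)

theorem degGE_le {e : ℕ} {H : AddSubgroup X} (h : ∀ i, e ≤ i → 𝒢 i ≤ H) : degGE 𝒢 e ≤ H := by
  intro x hx
  refine mem_of_gradedProj_mem (𝒢 := 𝒢) fun i => ?_
  by_cases hi : i < e
  · rw [hx i hi]; exact H.zero_mem
  · exact h i (by omega) (gradedProj_mem 𝒢 i x)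

variable (h𝒢 : SetLike.GradedSMul 𝒜 𝒢)
include h𝒢

omit [DirectSum.Decomposition 𝒢] [GradedAlgebra 𝒜] in
theorem homogeneous_smul_mem {i j : ℕ} {a : A} {x : X} (ha : a ∈ 𝒜 i) (hx : x ∈ 𝒢 j) :
    a • x ∈ 𝒢 (i + j) :=
  h𝒢.smul_mem ha hx

omit [GradedAlgebra 𝒜] in
theorem homogeneous_smul_mem_degGE {i e : ℕ} {a : A} {x : X} (ha : a ∈ 𝒜 i)
    (hx : x ∈ degGE 𝒢 e) : a • x ∈ degGE 𝒢 (i + e) := by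
  have : degGE 𝒢 e ≤ (degGE 𝒢 (i + e)).comap (DistribSMul.toAddMonoidHom X a) :=
    degGE_le fun j hj y hy =>
      mem_degGE_of_mem (by omega) (homogeneous_smul_mem h𝒢 ha hy)
  exact this hx

theorem smul_mem_degGE {e : ℕ} (a : A) {x : X} (hx : x ∈ degGE 𝒢 e) : a • x ∈ degGE 𝒢 e := by
  induction a using DirectSum.Decomposition.inductionOn 𝒜 with
  | zero => simp
  | add a b ha hb => rw [add_smul]; exact add_mem ha hb
  | @homogeneous i m =>
    exact degGE_anti (by omega) (homogeneous_smul_mem_degGE h𝒢 m.2 hx)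

theorem gradedRad_smul_mem_degGE {e : ℕ} {r : A} (hr : r ∈ gradedRad 𝒜) {x : X}
    (hx : x ∈ degGE 𝒢 e) : r • x ∈ degGE 𝒢 (e + 1) := by
  induction hr using Submodule.span_induction with
  | mem r hr =>
    obtain ⟨i, hi, hr⟩ := Set.mem_iUnion₂.1 hr
    have hi : 1 ≤ i := hi
    exact degGE_anti (by omega) (homogeneous_smul_mem_degGE h𝒢 hr hx)
  | zero => simp
  | add r s _ _ hr hs => rw [add_smul]; exact add_mem hr hs
  | smul a r _ hr => rw [smul_assoc]; exact smul_mem_degGE h𝒢 a hr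

theorem jSMul_gradedRad_le_degGE {e : ℕ} {K : Submodule A X}
    (hK : K.toAddSubgroup ≤ degGE 𝒢 e) :
    (jSMul (gradedRad 𝒜) K).toAddSubgroup ≤ degGE 𝒢 (e + 1) := by
  intro x hx
  replace hx : x ∈ jSMul (gradedRad 𝒜) K := hx
  induction hx using Submodule.span_induction with
  | mem x hx =>
    obtain ⟨r, hr, y, hy, rfl⟩ := hx
    exact gradedRad_smul_mem_degGE h𝒢 hr (hK hy)
  | zero => exact zero_mem _
  | add x y _ _ hx hy => exact add_mem hx hy
  | smul a x _ hx => exact smul_mem_degGE h𝒢 a hx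

theorem jPowSMul_top_le_degGE {d : ℕ} (hd : Submodule.span A (𝒢 d : Set X) = ⊤) (m : ℕ) :
    (jPowSMul (gradedRad 𝒜) m (⊤ : Submodule A X)).toAddSubgroup ≤ degGE 𝒢 (m + d) := by
  induction m with
  | zero =>
    intro x _
    rw [zero_add]
    induction (show x ∈ Submodule.span A (𝒢 d : Set X) from hd ▸ Submodule.mem_top)
      using Submodule.span_induction with
    | mem x hx => exact mem_degGE_of_mem le_rfl hx
    | zero => exact zero_mem _
    | add x y _ _ hx hy => exact add_mem (hx trivial) (hy trivial)
    | smul a x _ hx => exact smul_mem_degGE h𝒢 a (hx trivial)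
  | succ m ih => exact (jSMul_gradedRad_le_degGE h𝒢 ih).trans (degGE_anti (by omega))

theorem mem_jSMul_span_of_mem (hmul : ∀ i j, 𝒜 i * 𝒜 j = 𝒜 (i + j)) {d : ℕ}
    (hd : Submodule.span A (𝒢 d : Set X) = ⊤) (j : ℕ) {x : X} (hx : x ∈ 𝒢 (1 + j + d)) :
    x ∈ jSMul (gradedRad 𝒜) (Submodule.span A (𝒢 (j + d) : Set X)) := by
  set L := jSMul (gradedRad 𝒜) (Submodule.span A (𝒢 (j + d) : Set X))
  rw [← gradedProj_of_mem hx]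
  have hx' : x ∈ Submodule.span A (𝒢 d : Set X) := hd ▸ Submodule.mem_top
  clear hx
  induction hx' using Submodule.closure_induction with
  | zero => simp
  | add x y _ _ hx hy => rw [map_add]; exact add_mem hx hy
  | smul_mem a x hx =>
    induction a using DirectSum.Decomposition.inductionOn 𝒜 with
    | zero => simp
    | add a b ha hb => rw [add_smul, map_add]; exact add_mem ha hb
    | @homogeneous l a =>
      have hax := homogeneous_smul_mem h𝒢 a.2 hx
      by_cases hl : l = 1 + j
      · subst hl
        rw [gradedProj_of_mem hax]
        have ha : (a : A) ∈ 𝒜 1 * 𝒜 j := (hmul 1 j).symm ▸ a.2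
        generalize (a : A) = c at ha ⊢
        induction ha using Submodule.mul_induction_on' with
        | mem_mul_mem b hb c hc =>
          rw [mul_smul]
          exact smul_mem_jSMul (mem_gradedRad le_rfl hb)
            (Submodule.subset_span (homogeneous_smul_mem h𝒢 hc hx))
        | add b _ c _ hb hc => rw [add_smul]; exact add_mem hb hc
      · rw [gradedProj_of_mem_ne hax (by omega)]
        exact zero_mem _

theorem homogeneous_mem_jPowSMul (hmul : ∀ i j, 𝒜 i * 𝒜 j = 𝒜 (i + j)) {d : ℕ}
    (hd : Submodule.span A (𝒢 d : Set X) = ⊤) (m t : ℕ) {x : X} (hx : x ∈ 𝒢 (m + t + d)) :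
    x ∈ jPowSMul (gradedRad 𝒜) m (⊤ : Submodule A X) := by
  induction m generalizing x with
  | zero => trivial
  | succ m ih =>
    rw [show m + 1 + t + d = 1 + (m + t) + d by omega] at hx
    exact jSMul_mono _ (Submodule.span_le.2 fun y hy => ih hy)
      (mem_jSMul_span_of_mem h𝒢 hmul hd (m + t) hx)

omit h𝒢 in
theorem jSMul_gradedRad_top_le {H : AddSubgroup X}
    (hH : ∀ i j, 1 ≤ i → ∀ a ∈ 𝒜 i, ∀ x ∈ 𝒢 j, a • x ∈ H) :
    (jSMul (gradedRad 𝒜) (⊤ : Submodule A X)).toAddSubgroup ≤ H := by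
  have hom : ∀ i, 1 ≤ i → ∀ a ∈ 𝒜 i, ∀ x : X, a • x ∈ H := fun i hi a ha x => by
    induction x using DirectSum.Decomposition.inductionOn 𝒢 with
    | zero => simp
    | add x y hx hy => rw [smul_add]; exact add_mem hx hy
    | @homogeneous j x => exact hH i j hi a ha x x.2
  have rad : ∀ r ∈ gradedRad 𝒜, ∀ x : X, r • x ∈ H := fun r hr x => by
    induction hr using Submodule.closure_induction with
    | zero => simp
    | add r s _ _ hr hs => rw [add_smul]; exact add_mem hr hs
    | smul_mem a r hr =>
      obtain ⟨i, hi, hr⟩ := Set.mem_iUnion₂.1 hr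
      induction a using DirectSum.Decomposition.inductionOn 𝒜 with
      | zero => simp
      | add a b ha hb => rw [add_smul, add_smul]; exact add_mem ha hb
      | @homogeneous l a =>
        exact hom (l + i) (le_add_left hi) _ (SetLike.mul_mem_graded a.2 hr) x
  intro x hx
  replace hx : x ∈ jSMul (gradedRad 𝒜) ⊤ := hx
  induction hx using Submodule.closure_induction with
  | zero => exact zero_mem _
  | add x y _ _ hx hy => exact add_mem hx hy
  | smul_mem a x hx =>
    obtain ⟨r, hr, y, -, rfl⟩ := hx
    rw [← mul_smul]
    exact rad _ (Ideal.mul_mem_left _ a hr) y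

/-- Graded Nakayama lemma: a graded module whose homogeneous components of degree different
from `d` lie in `J·X` is generated in degree `d`. -/
theorem span_eq_top_of_le_jSMul {d : ℕ}
    (h : ∀ i, i ≠ d → ∀ x ∈ 𝒢 i, x ∈ jSMul (gradedRad 𝒜) (⊤ : Submodule A X)) :
    Submodule.span A (𝒢 d : Set X) = ⊤ := by
  set N := Submodule.span A (𝒢 d : Set X)
  have key : ∀ i, ∀ x ∈ 𝒢 i, x ∈ N := fun i => by
    induction i using Nat.strong_induction_on with
    | _ i ih =>
      intro x hx
      by_cases hi : i = d
      · subst hi; exact Submodule.subset_span hx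
      have hle : (jSMul (gradedRad 𝒜) (⊤ : Submodule A X)).toAddSubgroup ≤
          N.toAddSubgroup.comap (gradedProj 𝒢 i) := by
        refine jSMul_gradedRad_top_le (𝒢 := 𝒢) fun p q hp a ha y hy => ?_
        have hay := homogeneous_smul_mem h𝒢 ha hy
        rw [AddSubgroup.mem_comap]
        by_cases hpq : p + q = i
        · subst hpq
          rw [gradedProj_of_mem hay]
          exact N.smul_mem a (ih q (by omega) y hy)
        · rw [gradedProj_of_mem_ne hay hpq]
          exact zero_mem _
      have := hle (h i hi x hx)
      rwa [AddSubgroup.mem_comap, gradedProj_of_mem hx] at this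
  refine eq_top_iff.2 fun x _ => ?_
  exact mem_of_gradedProj_mem (𝒢 := 𝒢) (H := N.toAddSubgroup)
    fun i => key i _ (gradedProj_mem 𝒢 i x)

end Proj

variable {𝒢 : ℕ → AddSubgroup X} [DirectSum.Decomposition 𝒢]
  {𝒦 : ℕ → AddSubgroup Y} [DirectSum.Decomposition 𝒦]

theorem mem_jSMul_of_map_mem {f : X →ₗ[A] Y} (hker : LinearMap.ker f ≤ jSMul (gradedRad 𝒜) ⊤)
    {x : X} (hx : f x ∈ jSMul (gradedRad 𝒜) (LinearMap.range f)) :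
    x ∈ jSMul (gradedRad 𝒜) (⊤ : Submodule A X) := by
  rw [LinearMap.range_eq_map, ← map_jSMul] at hx
  obtain ⟨z, hz, hzx⟩ := hx
  rw [← sub_add_cancel x z]
  exact add_mem (hker (by simp [hzx])) hz

variable [GradedAlgebra 𝒜] (h𝒢 : SetLike.GradedSMul 𝒜 𝒢) (h𝒦 : SetLike.GradedSMul 𝒜 𝒦)
  (hmul : ∀ i j, 𝒜 i * 𝒜 j = 𝒜 (i + j)) {f : X →ₗ[A] Y}
  (hf : ∀ i x, x ∈ 𝒢 i → f x ∈ 𝒦 i) {m d : ℕ}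
include h𝒢 h𝒦 hmul hf

theorem range_condition_of_span_eq_top (hd : Submodule.span A (𝒦 d : Set Y) = ⊤)
    (hmd : Submodule.span A (𝒢 (m + d) : Set X) = ⊤) :
    LinearMap.range f ≤ jPowSMul (gradedRad 𝒜) m ⊤ ∧
      jSMul (gradedRad 𝒜) (LinearMap.range f) =
        LinearMap.range f ⊓ jPowSMul (gradedRad 𝒜) (m + 1) ⊤ := by
  have hle : LinearMap.range f ≤ jPowSMul (gradedRad 𝒜) m ⊤ := by
    rw [LinearMap.range_eq_map, ← hmd, Submodule.map_span_le]
    exact fun x hx => homogeneous_mem_jPowSMul h𝒦 hmul hd m 0 (hf _ x hx)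
  refine ⟨hle, le_antisymm (le_inf (jSMul_le_self _ _) (jSMul_mono _ hle)) ?_⟩
  rintro _ ⟨⟨x, rfl⟩, hx⟩
  have hx : f x ∈ degGE 𝒦 (m + 1 + d) := jPowSMul_top_le_degGE h𝒦 hd (m + 1) hx
  rw [LinearMap.range_eq_map, ← map_jSMul]
  refine mem_of_gradedProj_mem (𝒢 := 𝒦)
    (H := (Submodule.map f (jSMul (gradedRad 𝒜) ⊤)).toAddSubgroup) fun i => ?_
  by_cases hi : i < m + 1 + d
  · rw [hx i hi]; exact zero_mem _
  · rw [gradedProj_map hf]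
    obtain ⟨t, rfl⟩ := Nat.exists_eq_add_of_le (not_lt.1 hi)
    refine Submodule.mem_map_of_mem (homogeneous_mem_jPowSMul h𝒢 hmul hmd 1 t ?_)
    rw [show 1 + t + (m + d) = m + 1 + d + t by omega]
    exact gradedProj_mem 𝒢 _ x

theorem span_eq_top_of_range_condition (hker : LinearMap.ker f ≤ jSMul (gradedRad 𝒜) ⊤)
    (hd : Submodule.span A (𝒦 d : Set Y) = ⊤)
    (hle : LinearMap.range f ≤ jPowSMul (gradedRad 𝒜) m ⊤)
    (hJ : jSMul (gradedRad 𝒜) (LinearMap.range f) =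
      LinearMap.range f ⊓ jPowSMul (gradedRad 𝒜) (m + 1) ⊤) :
    Submodule.span A (𝒢 (m + d) : Set X) = ⊤ := by
  refine span_eq_top_of_le_jSMul h𝒢 fun i hi x hx => ?_
  have hfx := hf i x hx
  have hrange : f x ∈ LinearMap.range f := ⟨x, rfl⟩
  rcases Nat.lt_or_gt_of_ne hi with hi | hi
  · have h0 := jPowSMul_top_le_degGE h𝒦 hd m (hle hrange) i hi
    rw [gradedProj_of_mem hfx] at h0
    exact hker h0
  · refine mem_jSMul_of_map_mem hker ?_
    rw [hJ]
    obtain ⟨t, rfl⟩ := Nat.exists_eq_add_of_lt hi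
    refine ⟨hrange, homogeneous_mem_jPowSMul h𝒦 hmul hd (m + 1) t ?_⟩
    rwa [show m + 1 + t + d = m + d + t + 1 by omega]

/-- The source of a graded projective cover of a module generated in degree `d` is itself
generated in degree `d`. -/
theorem span_eq_top_of_surjective (hsurj : Function.Surjective f)
    (hker : LinearMap.ker f ≤ jSMul (gradedRad 𝒜) ⊤)
    (hd : Submodule.span A (𝒦 d : Set Y) = ⊤) : Submodule.span A (𝒢 d : Set X) = ⊤ := by
  have hrange : LinearMap.range f = ⊤ := LinearMap.range_eq_top.2 hsurj
  have := span_eq_top_of_range_condition h𝒢 h𝒦 hmul hf (m := 0) hker hd le_top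
    (by rw [hrange, top_inf_eq]; rfl)
  rwa [zero_add] at this

end GradedModules

namespace MinGradedProjRes

variable {k : Type} [Field k] {A : Type} [Ring A] [Algebra k A] {𝒜 : ℕ → Submodule k A}
  {X : Type} [AddCommGroup X] [Module A X] {𝒳 : ℕ → AddSubgroup X}
  (P : MinGradedProjRes k A 𝒜 X 𝒳)

theorem syz_eq_range (n : ℕ) : P.syz n = LinearMap.range (P.d n) := by
  cases n with
  | zero => exact P.exact0.symm
  | succ n => exact (P.exact n).symm

end MinGradedProjRes

/-- Corollary 2.5: for a minimal graded projective resolution of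
a finitely generated graded module `M` generated in degree `0` over a standard
graded algebra `A`, `M` is a `δ`-Koszul module (each `Pₙ` is generated in
degree `δ(n)`) iff for all `n`, `ker dₙ ⊆ J^{δ(n+1)-δ(n)}·Pₙ` and
`J·ker dₙ = ker dₙ ∩ J^{δ(n+1)-δ(n)+1}·Pₙ`. -/
theorem deltaKoszul_module_iff_syzygy_condition
    {k : Type} [Field k] {A : Type} [Ring A] [Algebra k A]
    (𝒜 : ℕ → Submodule k A) [GradedAlgebra 𝒜]
    (hstd : IsStandardGraded k A 𝒜)
    (δ : ℕ → ℕ) (hδ : StrictMono δ) (hδ0 : δ 0 = 0)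
    {M : Type} [AddCommGroup M] [Module A M] [Module.Finite A M]
    (ℳ : ℕ → AddSubgroup M) [DirectSum.Decomposition ℳ]
    (hgsmul : SetLike.GradedSMul 𝒜 ℳ)
    (hgen0 : Submodule.span A ((ℳ 0 : Set M)) = ⊤)
    (P : MinGradedProjRes k A 𝒜 M ℳ) :
    (∀ n, P.GenInDeg n (δ n)) ↔
    (∀ n, P.syz n ≤ jPowSMul (gradedRad 𝒜) (δ (n + 1) - δ n) ⊤ ∧
      jSMul (gradedRad 𝒜) (P.syz n) =
        P.syz n ⊓ jPowSMul (gradedRad 𝒜) (δ (n + 1) - δ n + 1) ⊤) := by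
  have hmul := hstd.2.1
  have hδs (n : ℕ) : δ (n + 1) - δ n + δ n = δ (n + 1) :=
    Nat.sub_add_cancel (hδ.monotone n.le_succ)
  simp only [P.syz_eq_range]
  constructor
  · intro h n
    refine range_condition_of_span_eq_top (P.gsmul (n + 1)) (P.gsmul n) hmul (P.d_graded n)
      (h n) ?_
    rw [hδs]
    exact h (n + 1)
  · intro h n
    induction n with
    | zero =>
      rw [hδ0]
      exact span_eq_top_of_surjective (P.gsmul 0) hgsmul hmul P.aug_graded P.aug_surj
        P.minimal0 hgen0
    | succ n ih =>
      have := span_eq_top_of_range_condition (P.gsmul (n + 1)) (P.gsmul n) hmul (P.d_graded n)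
        (P.minimal n) ih (h n).1 (h n).2
      rwa [hδs] at this
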